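/- Let w ∈ W be in reduced form and satisfy Hypothesis (E). Then for every i with 1 ≤ i ≤ n, one has w(i) ≠ i. -/

import Mathlib

/-!  Common framework: Weyl groups of classical groups, modeled as permutations of ℕ
supported on `{1,…,r₀}`, with the convention `i' = r₀ + 1 - i`. -/

/-- `IsWfull r₀ w`: `w` fixes every point outside `{1,…,r₀}` and commutes with the
involution `ι : i ↦ r₀ + 1 - i` on `{1,…,r₀}`.  This is the full group of permutations
of `{1,…,r₀}` commuting with `ι` (the Weyl group of `SO(2r+1)`, `U(2r+1)` or `U(2r)`). -/
def IsWfull (r₀ : ℕ) (w : Equiv.Perm ℕ) : Prop :=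
  (∀ i : ℕ, ¬(1 ≤ i ∧ i ≤ r₀) → w i = i) ∧
  (∀ i : ℕ, 1 ≤ i → i ≤ r₀ → w (r₀ + 1 - i) = r₀ + 1 - w i)

/-- The parity condition singling out the Weyl group of `SO(2r)`:
the number of indices `1 ≤ i ≤ r` with `w i > r` is even. -/
def EvenCond (r : ℕ) (w : Equiv.Perm ℕ) : Prop :=
  Even (((Finset.Icc 1 r).filter (fun i => r < w i)).card)

/-- Membership in `W`; the proposition `so2r` indicates whether we are in the `SO(2r)`
case (where the parity condition is imposed on top of `IsWfull`). -/
def MemW (r r₀ : ℕ) (so2r : Prop) (w : Equiv.Perm ℕ) : Prop :=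
  IsWfull r₀ w ∧ (so2r → EvenCond r w)

/-- Membership in `W_M`: an element of `W` with `w({1,…,n}) = {1,…,n}` and
`w({n+1,…,r₀−n}) = {n+1,…,r₀−n}`. -/
def MemWM (r r₀ n : ℕ) (so2r : Prop) (m : Equiv.Perm ℕ) : Prop :=
  MemW r r₀ so2r m ∧
  (Finset.Icc 1 n).image (fun i => m i) = Finset.Icc 1 n ∧
  (Finset.Icc (n + 1) (r₀ - n)).image (fun i => m i) = Finset.Icc (n + 1) (r₀ - n)

/-- The left coset `w·{m | P m}`. -/
def coset (P : Equiv.Perm ℕ → Prop) (w : Equiv.Perm ℕ) : Set (Equiv.Perm ℕ) :=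
  {x | ∃ m, P m ∧ x = w * m}

/-- `w` is in standard form: a product of pairwise disjoint transpositions
`∏ᵢ (aᵢ aᵢ') · ∏ᵢ (bᵢ cᵢ)(cᵢ' bᵢ')` with `aᵢ, bᵢ ∈ {1,…,n}` and `cᵢ ∈ {n+1,…,r₀−n}`.
This is encoded pointwise: `w` belongs to the full group `W`, is an involution, every
moved point `i ∈ {1,…,n}` has `w i = i'` or `w i ∈ {n+1,…,r₀−n}`, and every moved
point `i ∈ {n+1,…,r₀−n}` has `w i ∈ {1,…,n}` or `w i ∈ {n',…,r₀}`. -/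
def IsStandardForm (r₀ n : ℕ) (w : Equiv.Perm ℕ) : Prop :=
  IsWfull r₀ w ∧ w * w = 1 ∧
  (∀ i, 1 ≤ i → i ≤ n → w i ≠ i →
    (w i = r₀ + 1 - i ∨ (n + 1 ≤ w i ∧ w i ≤ r₀ - n))) ∧
  (∀ i, n + 1 ≤ i → i ≤ r₀ - n → w i ≠ i →
    (w i ≤ n ∨ r₀ + 1 - n ≤ w i))

/-- The 4-cycle `(a b c d)` sending `a ↦ b ↦ c ↦ d ↦ a`. -/
def cycle4 (a b c d : ℕ) : Equiv.Perm ℕ :=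
  Equiv.swap a b * Equiv.swap b c * Equiv.swap c d

/-- `w` is in reduced form: `w = w₁ w₂` with `w₁` in standard form, `w₂` disjoint from
`w₁`, and `w₂` either the identity, or (only in the `SO(2r)` case) a transposition
`(d₀ d₀')` with `n+1 ≤ d₀ ≤ r`, or a 4-cycle `(i₀ j₀' i₀' j₀)` with `1 ≤ i₀ ≤ n < j₀ ≤ r`. -/
def IsReducedForm (r r₀ n : ℕ) (so2r : Prop) (w : Equiv.Perm ℕ) : Prop :=
  ∃ w₁ w₂ : Equiv.Perm ℕ,
    IsStandardForm r₀ n w₁ ∧ w = w₁ * w₂ ∧ Equiv.Perm.Disjoint w₁ w₂ ∧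
    (w₂ = 1 ∨
      (so2r ∧
        ((∃ d₀, n + 1 ≤ d₀ ∧ d₀ ≤ r ∧ w₂ = Equiv.swap d₀ (r₀ + 1 - d₀)) ∨
         (∃ i₀ j₀, 1 ≤ i₀ ∧ i₀ ≤ n ∧ n < j₀ ∧ j₀ ≤ r ∧
            w₂ = cycle4 i₀ (r₀ + 1 - j₀) (r₀ + 1 - i₀) j₀))))

/-- The vector `e_i : {1,…,r₀} → ℤ` with `e_i(i) = 1`, `e_i(i') = −1`, `0` elsewhere. -/
def evec (r₀ i : ℕ) : ℕ → ℤ :=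
  fun k => if k = i then 1 else if k = r₀ + 1 - i then -1 else 0

/-- The simple root `α_i = e_i − e_{i+1}`. -/
def rootAlpha (r₀ i : ℕ) : ℕ → ℤ := evec r₀ i - evec r₀ (i + 1)

/-- The root `β = e_ℓ + e_{ℓ+1}`. -/
def rootBeta (r₀ l : ℕ) : ℕ → ℤ := evec r₀ l + evec r₀ (l + 1)

/-- The action of `w` on root vectors: `(w·v)(k) = v(w⁻¹ k)`. -/
def pact (w : Equiv.Perm ℕ) (v : ℕ → ℤ) : ℕ → ℤ := fun k => v (w⁻¹ k)

/-- The set `X = {α_1,…,α_ℓ, β}`. -/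
def Xset (r₀ l : ℕ) : Set (ℕ → ℤ) :=
  {v | (∃ i, 1 ≤ i ∧ i ≤ l ∧ v = rootAlpha r₀ i) ∨ v = rootBeta r₀ l}

/-- The set of short and long roots `{e_i, 2e_i : 1 ≤ i ≤ n}` from which `S₀` is drawn. -/
def ShortLong (r₀ n : ℕ) : Set (ℕ → ℤ) :=
  {v | ∃ i, 1 ≤ i ∧ i ≤ n ∧ (v = evec r₀ i ∨ v = evec r₀ i + evec r₀ i)}

/-- `Σ_P^+ = {e_i ± e_j : 1 ≤ i ≤ n < j ≤ r} ∪ {e_i + e_j : 1 ≤ i < j ≤ n} ∪ S₀`. -/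
def SigmaP (r r₀ n : ℕ) (S₀ : Set (ℕ → ℤ)) : Set (ℕ → ℤ) :=
  {v | ∃ i j, 1 ≤ i ∧ i ≤ n ∧ n < j ∧ j ≤ r ∧
        (v = evec r₀ i - evec r₀ j ∨ v = evec r₀ i + evec r₀ j)} ∪
  {v | ∃ i j, 1 ≤ i ∧ i < j ∧ j ≤ n ∧ v = evec r₀ i + evec r₀ j} ∪ S₀

/-- Hypothesis (E): `w·α ∉ X` for every `α ∈ Σ_P^+`. -/
def HypE (r r₀ n l : ℕ) (S₀ : Set (ℕ → ℤ)) (w : Equiv.Perm ℕ) : Prop :=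
  ∀ α ∈ SigmaP r r₀ n S₀, pact w α ∉ Xset r₀ l

/-- Hypothesis (L): `α_ℓ = w·α` for some `α ∈ Σ_P^+`; no other element of `X` is of the
form `w·α` with `α ∈ Σ_P^+`; and `w⁻¹·α_ℓ` is not of the form `e_i + e_j` with
`1 ≤ i, j ≤ n`. -/
def HypL (r r₀ n l : ℕ) (S₀ : Set (ℕ → ℤ)) (w : Equiv.Perm ℕ) : Prop :=
  (∃ α ∈ SigmaP r r₀ n S₀, pact w α = rootAlpha r₀ l) ∧
  (∀ α ∈ SigmaP r r₀ n S₀, pact w α ∈ Xset r₀ l → pact w α = rootAlpha r₀ l) ∧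
  ¬ ∃ i j, 1 ≤ i ∧ i ≤ n ∧ 1 ≤ j ∧ j ≤ n ∧
      pact w⁻¹ (rootAlpha r₀ l) = evec r₀ i + evec r₀ j

/-- The permutation `(1 r₀)(2 r₀−1)⋯(n n')`. -/
def w0base (r₀ n : ℕ) : Equiv.Perm ℕ :=
  (((List.range n).map (fun i => Equiv.swap (i + 1) (r₀ - i))).prod)
theorem IsWfull.pact_evec {r₀ : ℕ} {w : Equiv.Perm ℕ} (hw : IsWfull r₀ w) {i : ℕ}
    (h1 : 1 ≤ i) (h2 : i ≤ r₀) : pact w (evec r₀ i) = evec r₀ (w i) := by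
  funext k
  simp only [pact, evec, Equiv.Perm.inv_eq_iff_eq, ← hw.2 i h1 h2]

theorem IsWfull.mem_range_of_apply {r₀ : ℕ} {w : Equiv.Perm ℕ} (hw : IsWfull r₀ w) {i : ℕ}
    (h1 : 1 ≤ w i) (h2 : w i ≤ r₀) : 1 ≤ i ∧ i ≤ r₀ := by
  by_contra h
  rw [hw.1 i h] at h1 h2
  exact h ⟨h1, h2⟩

theorem evec_reflect {r₀ i : ℕ} (h2 : i ≤ r₀) (hne : i ≠ r₀ + 1 - i) :
    evec r₀ (r₀ + 1 - i) = -evec r₀ i := by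
  have hi : r₀ + 1 - (r₀ + 1 - i) = i := by omega
  funext k
  simp only [evec, Pi.neg_apply, hi]
  split_ifs <;> omega

theorem pact_add (w : Equiv.Perm ℕ) (u v : ℕ → ℤ) : pact w (u + v) = pact w u + pact w v := rfl

theorem pact_sub (w : Equiv.Perm ℕ) (u v : ℕ → ℤ) : pact w (u - v) = pact w u - pact w v := rfl

theorem evec_add_evec_mem_SigmaP {r r₀ n a b : ℕ} (S₀ : Set (ℕ → ℤ)) (ha : 1 ≤ a) (han : a ≤ n)
    (hb : 1 ≤ b) (hbn : b ≤ n) (hab : a ≠ b) : evec r₀ a + evec r₀ b ∈ SigmaP r r₀ n S₀ := by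
  rcases hab.lt_or_gt with h | h
  · exact Or.inl (Or.inr ⟨a, b, ha, h, hbn, rfl⟩)
  · exact Or.inl (Or.inr ⟨b, a, hb, h, han, add_comm _ _⟩)

/-- If `a ≤ n` and `k` is none of `1, …, n`, `a'` or the middle index,
then `e_a - e_k` lies in `Σ_P^+`. -/
theorem evec_sub_evec_mem_SigmaP {r r₀ n a k : ℕ} (S₀ : Set (ℕ → ℤ)) (hr₀ : r₀ ≤ 2 * r + 1)
    (ha : 1 ≤ a) (han : a ≤ n) (hnk : n < k) (hk : k ≤ r₀)
    (hka : k ≠ r₀ + 1 - a) (hmid : k ≠ r₀ + 1 - k) :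
    evec r₀ a - evec r₀ k ∈ SigmaP r r₀ n S₀ := by
  by_cases hkr : k ≤ r
  · exact Or.inl (Or.inl ⟨a, k, ha, han, hnk, hkr, Or.inl rfl⟩)
  have hneg : evec r₀ a - evec r₀ k = evec r₀ a + evec r₀ (r₀ + 1 - k) := by
    rw [evec_reflect hk hmid, sub_eq_add_neg]
  rw [hneg]
  by_cases hkn : r₀ + 1 - k ≤ n
  · exact evec_add_evec_mem_SigmaP S₀ ha han (by omega) hkn (by omega)
  · exact Or.inl (Or.inl ⟨a, r₀ + 1 - k, ha, han, by omega, by omega, Or.inr rfl⟩)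

/-- if `w ∈ W` is in reduced form and satisfies Hypothesis (E), then
`w i ≠ i` for all `1 ≤ i ≤ n`. -/
theorem stmt6 (r n ℓ r₀ : ℕ) (so2r : Prop)
    (hn : 1 ≤ n) (hnl : n ≤ ℓ) (hlr : ℓ + 1 ≤ r)
    (hr₀ : r₀ = 2 * r ∨ r₀ = 2 * r + 1) (hso : so2r → r₀ = 2 * r)
    (S₀ : Set (ℕ → ℤ)) (hS₀ : S₀ ⊆ ShortLong r₀ n)
    (w : Equiv.Perm ℕ) (hw : MemW r r₀ so2r w)
    (hred : IsReducedForm r r₀ n so2r w)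
    (hE : HypE r r₀ n ℓ S₀ w) :
    ∀ i, 1 ≤ i → i ≤ n → w i ≠ i := by
  intro i hi1 hin hfix
  have hW := hw.1
  have hmem : ∀ j, i ≤ j → j ≤ ℓ + 1 → 1 ≤ w⁻¹ j ∧ w⁻¹ j ≤ n := by
    intro j hij
    induction j, hij using Nat.le_induction with
    | base =>
      intro _
      rw [Equiv.Perm.inv_eq_iff_eq.2 hfix.symm]
      exact ⟨hi1, hin⟩
    | succ j hij ih =>
      intro hj
      obtain ⟨ha1, han⟩ := ih (by omega)
      have hwa : w (w⁻¹ j) = j := w.apply_symm_apply j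
      have hwk : w (w⁻¹ (j + 1)) = j + 1 := w.apply_symm_apply (j + 1)
      generalize w⁻¹ j = a at *
      generalize w⁻¹ (j + 1) = k at *
      obtain ⟨hk1, hk2⟩ := hW.mem_range_of_apply (i := k) (by omega) (by omega)
      refine ⟨hk1, ?_⟩
      by_contra hkn
      refine hE _ (evec_sub_evec_mem_SigmaP S₀ (k := k) (by omega) ha1 han (by omega) hk2 ?_ ?_)
        (Or.inl ⟨j, by omega, by omega, ?_⟩)
      · intro h
        have := hW.2 a ha1 (by omega)
        rw [← h] at this
        omega
      · intro h
        have := hW.2 k hk1 hk2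
        rw [← h] at this
        omega
      · rw [pact_sub, hW.pact_evec ha1 (by omega), hW.pact_evec hk1 hk2, hwa, hwk, rootAlpha]
  obtain ⟨ha1, han⟩ := hmem ℓ (by omega) (by omega)
  obtain ⟨hb1, hbn⟩ := hmem (ℓ + 1) (by omega) le_rfl
  refine hE _ (evec_add_evec_mem_SigmaP S₀ ha1 han hb1 hbn
    (w⁻¹.injective.ne (Nat.succ_ne_self ℓ).symm)) (Or.inr ?_)
  rw [pact_add, hW.pact_evec ha1 (by omega), hW.pact_evec hb1 (by omega),
    show w (w⁻¹ ℓ) = ℓ from w.apply_symm_apply ℓ,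
    show w (w⁻¹ (ℓ + 1)) = ℓ + 1 from w.apply_symm_apply (ℓ + 1), rootBeta]
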